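/- Fix the D₄⁺ normal form f with a > 0, with unit normal ν near the origin, and let H = (EN − 2FM + GL)/(2(EG − F²)) be the mean curvature of f, defined near the origin where uv ≠ 0. Then the function (u,v) ↦ u·v·H(u,v) extends to a C¹ function h on a neighborhood of the origin with h(0,0) = 0, ∂h/∂u(0,0) = 3(1+a²)c₃(0)/(32a²) and ∂h/∂v(0,0) = 3(1+a²)c₁(0)/(32a²). -/

import Mathlib

open Real Filter Topology

noncomputable section

/-- Euclidean inner product on `ℝ³` (realized as `Fin 3 → ℝ`). -/
def dot3 (x y : Fin 3 → ℝ) : ℝ := x 0 * y 0 + x 1 * y 1 + x 2 * y 2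

/-- Euclidean norm on `ℝ³`. -/
def norm3 (x : Fin 3 → ℝ) : ℝ := Real.sqrt (dot3 x x)

/-- Cross product on `ℝ³`. -/
def cross3 (x y : Fin 3 → ℝ) : Fin 3 → ℝ :=
  ![x 1 * y 2 - x 2 * y 1, x 2 * y 0 - x 0 * y 2, x 0 * y 1 - x 1 * y 0]

/-- Determinant of the `3 × 3` matrix whose columns are `x`, `y`, `z`. -/
def det3 (x y z : Fin 3 → ℝ) : ℝ := Matrix.det (Matrix.of ![x, y, z]).transpose

/-- Partial derivative with respect to the first variable. -/
def pd1 {E : Type*} [NormedAddCommGroup E] [NormedSpace ℝ E]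
    (g : ℝ × ℝ → E) (p : ℝ × ℝ) : E := deriv (fun u => g (u, p.2)) p.1

/-- Partial derivative with respect to the second variable. -/
def pd2 {E : Type*} [NormedAddCommGroup E] [NormedSpace ℝ E]
    (g : ℝ × ℝ → E) (p : ℝ × ℝ) : E := deriv (fun v => g (p.1, v)) p.2

/-- The building block `u³·g₁(u) + u²v²·g₂(u,v) + v³·g₃(v)`. -/
def BC (g1 g3 : ℝ → ℝ) (g2 : ℝ × ℝ → ℝ) (p : ℝ × ℝ) : ℝ :=
  p.1 ^ 3 * g1 p.1 + p.1 ^ 2 * p.2 ^ 2 * g2 p + p.2 ^ 3 * g3 p.2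

/-- The D₄⁺ normal form
`f(u,v) = (u² − v², a(u² + v²) + b(u,v), c(u,v))`. -/
def NF (a : ℝ) (b1 b3 c1 c3 : ℝ → ℝ) (b2 c2 : ℝ × ℝ → ℝ) (p : ℝ × ℝ) : Fin 3 → ℝ :=
  ![p.1 ^ 2 - p.2 ^ 2, a * (p.1 ^ 2 + p.2 ^ 2) + BC b1 b3 b2 p, BC c1 c3 c2 p]

/-- The vector field `φ₁` with `∂f/∂u = u·φ₁`. -/
def Phi1 (a : ℝ) (b1 c1 : ℝ → ℝ) (b2 c2 : ℝ × ℝ → ℝ) (p : ℝ × ℝ) : Fin 3 → ℝ :=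
  ![2, 2 * a + 3 * p.1 * b1 p.1 + p.1 ^ 2 * deriv b1 p.1 + 2 * p.2 ^ 2 * b2 p +
      p.1 * p.2 ^ 2 * pd1 b2 p,
    3 * p.1 * c1 p.1 + p.1 ^ 2 * deriv c1 p.1 + 2 * p.2 ^ 2 * c2 p +
      p.1 * p.2 ^ 2 * pd1 c2 p]

/-- The vector field `φ₂` with `∂f/∂v = v·φ₂`. -/
def Phi2 (a : ℝ) (b3 c3 : ℝ → ℝ) (b2 c2 : ℝ × ℝ → ℝ) (p : ℝ × ℝ) : Fin 3 → ℝ :=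
  ![-2, 2 * a + 3 * p.2 * b3 p.2 + p.2 ^ 2 * deriv b3 p.2 + 2 * p.1 ^ 2 * b2 p +
      p.1 ^ 2 * p.2 * pd2 b2 p,
    3 * p.2 * c3 p.2 + p.2 ^ 2 * deriv c3 p.2 + 2 * p.1 ^ 2 * c2 p +
      p.1 ^ 2 * p.2 * pd2 c2 p]

/-- The unit normal `ν = (φ₁ × φ₂)/‖φ₁ × φ₂‖` of the D₄⁺ normal form. -/
def nuNF (a : ℝ) (b1 b3 c1 c3 : ℝ → ℝ) (b2 c2 : ℝ × ℝ → ℝ) (p : ℝ × ℝ) : Fin 3 → ℝ :=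
  (norm3 (cross3 (Phi1 a b1 c1 b2 c2 p) (Phi2 a b3 c3 b2 c2 p)))⁻¹ •
    cross3 (Phi1 a b1 c1 b2 c2 p) (Phi2 a b3 c3 b2 c2 p)

/-- The distance squared function `d_x(u,v) = ‖x − f(u,v)‖²/2`. -/
def dsq (f : ℝ × ℝ → Fin 3 → ℝ) (x : Fin 3 → ℝ) (p : ℝ × ℝ) : ℝ :=
  dot3 (x - f p) (x - f p) / 2

/-- The mean curvature `H = (EN − 2FM + GL)/(2(EG − F²))` of the D₄⁺ normal form. -/
def Hm (a : ℝ) (b1 b3 c1 c3 : ℝ → ℝ) (b2 c2 : ℝ × ℝ → ℝ) (p : ℝ × ℝ) : ℝ :=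
  (dot3 (pd1 (NF a b1 b3 c1 c3 b2 c2) p) (pd1 (NF a b1 b3 c1 c3 b2 c2) p) *
      dot3 (pd2 (pd2 (NF a b1 b3 c1 c3 b2 c2)) p) (nuNF a b1 b3 c1 c3 b2 c2 p) -
    2 * dot3 (pd1 (NF a b1 b3 c1 c3 b2 c2) p) (pd2 (NF a b1 b3 c1 c3 b2 c2) p) *
      dot3 (pd2 (pd1 (NF a b1 b3 c1 c3 b2 c2)) p) (nuNF a b1 b3 c1 c3 b2 c2 p) +
    dot3 (pd2 (NF a b1 b3 c1 c3 b2 c2) p) (pd2 (NF a b1 b3 c1 c3 b2 c2) p) *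
      dot3 (pd1 (pd1 (NF a b1 b3 c1 c3 b2 c2)) p) (nuNF a b1 b3 c1 c3 b2 c2 p)) /
  (2 * (dot3 (pd1 (NF a b1 b3 c1 c3 b2 c2) p) (pd1 (NF a b1 b3 c1 c3 b2 c2) p) *
      dot3 (pd2 (NF a b1 b3 c1 c3 b2 c2) p) (pd2 (NF a b1 b3 c1 c3 b2 c2) p) -
    dot3 (pd1 (NF a b1 b3 c1 c3 b2 c2) p) (pd2 (NF a b1 b3 c1 c3 b2 c2) p) ^ 2))

lemma aux_pd1_has {E : Type*} [NormedAddCommGroup E] [NormedSpace ℝ E] {g : ℝ × ℝ → E}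
    {p : ℝ × ℝ} (hg : DifferentiableAt ℝ g p) :
    HasDerivAt (fun u => g (u, p.2)) (fderiv ℝ g p (1, 0)) p.1 := by
  have h2 : HasDerivAt (fun u : ℝ => ((u, p.2) : ℝ × ℝ)) (1, 0) p.1 :=
    (hasDerivAt_id p.1).prodMk (hasDerivAt_const p.1 p.2)
  exact HasFDerivAt.comp_hasDerivAt (l := g) p.1 (by simpa using hg.hasFDerivAt) h2

lemma aux_pd2_has {E : Type*} [NormedAddCommGroup E] [NormedSpace ℝ E] {g : ℝ × ℝ → E}
    {p : ℝ × ℝ} (hg : DifferentiableAt ℝ g p) :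
    HasDerivAt (fun v => g (p.1, v)) (fderiv ℝ g p (0, 1)) p.2 := by
  have h2 : HasDerivAt (fun v : ℝ => ((p.1, v) : ℝ × ℝ)) (0, 1) p.2 :=
    (hasDerivAt_const p.2 p.1).prodMk (hasDerivAt_id p.2)
  exact HasFDerivAt.comp_hasDerivAt (l := g) p.2 (by simpa using hg.hasFDerivAt) h2

lemma aux_h1 {E : Type*} [NormedAddCommGroup E] [NormedSpace ℝ E] {g : ℝ × ℝ → E}
    (hg : ContDiff ℝ (⊤ : ℕ∞) g) (u v : ℝ) :
    HasDerivAt (fun u => g (u, v)) (pd1 g (u, v)) u := by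
  have := aux_pd1_has (p := (u, v)) (hg.differentiable (by simp) (u, v))
  have h2 : pd1 g (u, v) = _ := this.deriv
  rw [h2]; exact this

lemma aux_h2 {E : Type*} [NormedAddCommGroup E] [NormedSpace ℝ E] {g : ℝ × ℝ → E}
    (hg : ContDiff ℝ (⊤ : ℕ∞) g) (u v : ℝ) :
    HasDerivAt (fun v => g (u, v)) (pd2 g (u, v)) v := by
  have := aux_pd2_has (p := (u, v)) (hg.differentiable (by simp) (u, v))
  have h2 : pd2 g (u, v) = _ := this.deriv
  rw [h2]; exact this

lemma aux_c1 {E : Type*} [NormedAddCommGroup E] [NormedSpace ℝ E] {g : ℝ × ℝ → E}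
    (hg : ContDiff ℝ (⊤ : ℕ∞) g) : ContDiff ℝ (⊤ : ℕ∞) (pd1 g) := by
  have : pd1 g = fun p => fderiv ℝ g p (1, 0) := by
    funext p; exact (aux_pd1_has (hg.differentiable (by simp) p)).deriv
  rw [this]
  exact (hg.fderiv_right (m := (⊤ : ℕ∞)) (by simp)).clm_apply contDiff_const

lemma aux_c2 {E : Type*} [NormedAddCommGroup E] [NormedSpace ℝ E] {g : ℝ × ℝ → E}
    (hg : ContDiff ℝ (⊤ : ℕ∞) g) : ContDiff ℝ (⊤ : ℕ∞) (pd2 g) := by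
  have : pd2 g = fun p => fderiv ℝ g p (0, 1) := by
    funext p; exact (aux_pd2_has (hg.differentiable (by simp) p)).deriv
  rw [this]
  exact (hg.fderiv_right (m := (⊤ : ℕ∞)) (by simp)).clm_apply contDiff_const

lemma aux_cd {g : ℝ → ℝ} (hg : ContDiff ℝ (⊤ : ℕ∞) g) : ContDiff ℝ (⊤ : ℕ∞) (deriv g) :=
  (contDiff_infty_iff_deriv.1 hg).2

lemma aux_hd {g : ℝ → ℝ} (hg : ContDiff ℝ (⊤ : ℕ∞) g) (u : ℝ) : HasDerivAt g (deriv g u) u :=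
  (hg.differentiable (by simp) u).hasDerivAt

lemma aux_vec {f g k : ℝ × ℝ → ℝ} (hf : ContDiff ℝ (⊤ : ℕ∞) f) (hg : ContDiff ℝ (⊤ : ℕ∞) g)
    (hk : ContDiff ℝ (⊤ : ℕ∞) k) :
    ContDiff ℝ (⊤ : ℕ∞) (fun p => (![f p, g p, k p] : Fin 3 → ℝ)) := by
  rw [contDiff_pi]
  intro i
  fin_cases i
  · simpa using hf
  · simpa using hg
  · simpa using hk

lemma aux_vecd {f g k : ℝ → ℝ} {f' g' k' x : ℝ} (hf : HasDerivAt f f' x)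
    (hg : HasDerivAt g g' x) (hk : HasDerivAt k k' x) :
    HasDerivAt (fun p => (![f p, g p, k p] : Fin 3 → ℝ)) ![f', g', k'] x := by
  rw [hasDerivAt_pi]
  intro i
  fin_cases i
  · simpa using hf
  · simpa using hg
  · simpa using hk

lemma aux_dot {f g : ℝ × ℝ → Fin 3 → ℝ} (hf : ContDiff ℝ (⊤ : ℕ∞) f)
    (hg : ContDiff ℝ (⊤ : ℕ∞) g) : ContDiff ℝ (⊤ : ℕ∞) (fun p => dot3 (f p) (g p)) := by
  rw [contDiff_pi] at hf hg
  unfold dot3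
  exact (((hf 0).mul (hg 0)).add ((hf 1).mul (hg 1))).add ((hf 2).mul (hg 2))

lemma aux_cross {f g : ℝ × ℝ → Fin 3 → ℝ} (hf : ContDiff ℝ (⊤ : ℕ∞) f)
    (hg : ContDiff ℝ (⊤ : ℕ∞) g) : ContDiff ℝ (⊤ : ℕ∞) (fun p => cross3 (f p) (g p)) := by
  rw [contDiff_pi] at hf hg
  unfold cross3
  exact aux_vec (((hf 1).mul (hg 2)).sub ((hf 2).mul (hg 1)))
    (((hf 2).mul (hg 0)).sub ((hf 0).mul (hg 2))) (((hf 0).mul (hg 1)).sub ((hf 1).mul (hg 0)))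

lemma aux_s1 {g : ℝ → ℝ} (hg : ContDiff ℝ (⊤ : ℕ∞) g) :
    ContDiff ℝ (⊤ : ℕ∞) (fun p : ℝ × ℝ => g p.1) := hg.comp contDiff_fst

lemma aux_s2 {g : ℝ → ℝ} (hg : ContDiff ℝ (⊤ : ℕ∞) g) :
    ContDiff ℝ (⊤ : ℕ∞) (fun p : ℝ × ℝ => g p.2) := hg.comp contDiff_snd

/-- first scalar component -/
def comp1 (k : ℝ) (g1 : ℝ → ℝ) (g2 : ℝ × ℝ → ℝ) (p : ℝ × ℝ) : ℝ :=
  k + 3 * p.1 * g1 p.1 + p.1 ^ 2 * deriv g1 p.1 + 2 * p.2 ^ 2 * g2 p + p.1 * p.2 ^ 2 * pd1 g2 p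

/-- second scalar component -/
def comp2 (k : ℝ) (g3 : ℝ → ℝ) (g2 : ℝ × ℝ → ℝ) (p : ℝ × ℝ) : ℝ :=
  k + 3 * p.2 * g3 p.2 + p.2 ^ 2 * deriv g3 p.2 + 2 * p.1 ^ 2 * g2 p + p.1 ^ 2 * p.2 * pd2 g2 p

/-- the quotient of the mixed derivative -/
def psi (g2 : ℝ × ℝ → ℝ) (p : ℝ × ℝ) : ℝ :=
  4 * g2 p + 2 * p.2 * pd2 g2 p + 2 * p.1 * pd1 g2 p + p.1 * p.2 * pd2 (pd1 g2) p

lemma phi1_eq (a : ℝ) (b1 c1 : ℝ → ℝ) (b2 c2 : ℝ × ℝ → ℝ) :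
    Phi1 a b1 c1 b2 c2 = fun p => ![2, comp1 (2 * a) b1 b2 p, comp1 0 c1 c2 p] := by
  funext p; simp [Phi1, comp1]

lemma phi2_eq (a : ℝ) (b3 c3 : ℝ → ℝ) (b2 c2 : ℝ × ℝ → ℝ) :
    Phi2 a b3 c3 b2 c2 = fun p => ![-2, comp2 (2 * a) b3 b2 p, comp2 0 c3 c2 p] := by
  funext p; simp [Phi2, comp2]

lemma comp1_smooth (k : ℝ) {g1 : ℝ → ℝ} {g2 : ℝ × ℝ → ℝ} (h1 : ContDiff ℝ (⊤ : ℕ∞) g1)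
    (h2 : ContDiff ℝ (⊤ : ℕ∞) g2) : ContDiff ℝ (⊤ : ℕ∞) (comp1 k g1 g2) := by
  have e1 := aux_s1 h1
  have e2 := aux_s1 (aux_cd h1)
  have e3 := aux_c1 h2
  unfold comp1
  fun_prop

lemma comp2_smooth (k : ℝ) {g3 : ℝ → ℝ} {g2 : ℝ × ℝ → ℝ} (h1 : ContDiff ℝ (⊤ : ℕ∞) g3)
    (h2 : ContDiff ℝ (⊤ : ℕ∞) g2) : ContDiff ℝ (⊤ : ℕ∞) (comp2 k g3 g2) := by
  have e1 := aux_s2 h1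
  have e2 := aux_s2 (aux_cd h1)
  have e3 := aux_c2 h2
  unfold comp2
  fun_prop

lemma psi_smooth {g2 : ℝ × ℝ → ℝ}
    (h2 : ContDiff ℝ (⊤ : ℕ∞) g2) : ContDiff ℝ (⊤ : ℕ∞) (psi g2) := by
  have e1 := aux_c1 h2
  have e2 := aux_c2 h2
  have e3 := aux_c2 (aux_c1 h2)
  unfold psi
  fun_prop

lemma phi1_smooth (a : ℝ) {b1 c1 : ℝ → ℝ} {b2 c2 : ℝ × ℝ → ℝ}
    (hb1 : ContDiff ℝ (⊤ : ℕ∞) b1) (hc1 : ContDiff ℝ (⊤ : ℕ∞) c1)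
    (hb2 : ContDiff ℝ (⊤ : ℕ∞) b2) (hc2 : ContDiff ℝ (⊤ : ℕ∞) c2) :
    ContDiff ℝ (⊤ : ℕ∞) (Phi1 a b1 c1 b2 c2) := by
  rw [phi1_eq]
  exact aux_vec contDiff_const (comp1_smooth _ hb1 hb2) (comp1_smooth _ hc1 hc2)

lemma phi2_smooth (a : ℝ) {b3 c3 : ℝ → ℝ} {b2 c2 : ℝ × ℝ → ℝ}
    (hb3 : ContDiff ℝ (⊤ : ℕ∞) b3) (hc3 : ContDiff ℝ (⊤ : ℕ∞) c3)
    (hb2 : ContDiff ℝ (⊤ : ℕ∞) b2) (hc2 : ContDiff ℝ (⊤ : ℕ∞) c2) :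
    ContDiff ℝ (⊤ : ℕ∞) (Phi2 a b3 c3 b2 c2) := by
  rw [phi2_eq]
  exact aux_vec contDiff_const (comp2_smooth _ hb3 hb2) (comp2_smooth _ hc3 hc2)

lemma comp1_mixed (k : ℝ) (g1 : ℝ → ℝ) {g2 : ℝ × ℝ → ℝ}
    (h2 : ContDiff ℝ (⊤ : ℕ∞) g2) (u v : ℝ) :
    HasDerivAt (fun v => comp1 k g1 g2 (u, v)) (v * psi g2 (u, v)) v := by
  have e1 := aux_h2 h2 u v
  have e2 := aux_h2 (aux_c1 h2) u v
  have e3 := hasDerivAt_pow 2 v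
  have := (((e3.const_mul 2).mul e1).const_add
    (k + 3 * u * g1 u + u ^ 2 * deriv g1 u)).add ((e3.const_mul u).mul e2)
  refine this.congr_deriv ?_
  simp [psi]; ring

lemma bc_d1 (k : ℝ) {g1 g3 : ℝ → ℝ} {g2 : ℝ × ℝ → ℝ} (h1 : ContDiff ℝ (⊤ : ℕ∞) g1)
    (h2 : ContDiff ℝ (⊤ : ℕ∞) g2) (u v : ℝ) :
    HasDerivAt (fun u => k * (u ^ 2 + v ^ 2) + BC g1 g3 g2 (u, v))
      (u * comp1 (2 * k) g1 g2 (u, v)) u := by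
  have e1 := aux_h1 h2 u v
  have e2 := aux_hd h1 u
  have e3 := hasDerivAt_pow 2 u
  have e4 := hasDerivAt_pow 3 u
  have := ((e3.add_const (v ^ 2)).const_mul k).add
    (((e4.mul e2).add ((e3.mul_const (v ^ 2)).mul e1)).add_const (v ^ 3 * g3 v))
  refine this.congr_deriv ?_
  simp [comp1]; ring

lemma bc_d2 (k : ℝ) {g1 g3 : ℝ → ℝ} {g2 : ℝ × ℝ → ℝ} (h1 : ContDiff ℝ (⊤ : ℕ∞) g3)
    (h2 : ContDiff ℝ (⊤ : ℕ∞) g2) (u v : ℝ) :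
    HasDerivAt (fun v => k * (u ^ 2 + v ^ 2) + BC g1 g3 g2 (u, v))
      (v * comp2 (2 * k) g3 g2 (u, v)) v := by
  have e1 := aux_h2 h2 u v
  have e2 := aux_hd h1 v
  have e3 := hasDerivAt_pow 2 v
  have e4 := hasDerivAt_pow 3 v
  have := ((e3.const_add (u ^ 2)).const_mul k).add
    ((((e3.const_mul (u ^ 2)).mul e1).const_add (u ^ 3 * g1 u)).add (e4.mul e2))
  refine this.congr_deriv ?_
  simp [comp2]; ring

lemma comp2_zero (k : ℝ) {g3 : ℝ → ℝ} (g2 : ℝ × ℝ → ℝ) (h1 : ContDiff ℝ (⊤ : ℕ∞) g3) :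
    HasDerivAt (fun v => comp2 k g3 g2 (0, v)) (3 * g3 0) 0 := by
  have e1 := aux_hd h1 0
  have e2 := aux_hd (aux_cd h1) 0
  have := ((((hasDerivAt_id (0 : ℝ)).const_mul 3).mul e1).const_add k).add
    ((hasDerivAt_pow 2 (0 : ℝ)).mul e2)
  refine (this.congr_deriv (g' := 3 * g3 0) (by simp)).congr_of_eventuallyEq ?_
  refine Filter.Eventually.of_forall fun v => ?_
  simp [comp2]

lemma comp1_zero (k : ℝ) {g1 : ℝ → ℝ} (g2 : ℝ × ℝ → ℝ) (h1 : ContDiff ℝ (⊤ : ℕ∞) g1) :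
    HasDerivAt (fun u => comp1 k g1 g2 (u, 0)) (3 * g1 0) 0 := by
  have e1 := aux_hd h1 0
  have e2 := aux_hd (aux_cd h1) 0
  have := ((((hasDerivAt_id (0 : ℝ)).const_mul 3).mul e1).const_add k).add
    ((hasDerivAt_pow 2 (0 : ℝ)).mul e2)
  refine (this.congr_deriv (g' := 3 * g1 0) (by simp)).congr_of_eventuallyEq ?_
  refine Filter.Eventually.of_forall fun v => ?_
  simp [comp1]

section
variable (a : ℝ) (b1 b3 c1 c3 : ℝ → ℝ) (b2 c2 : ℝ × ℝ → ℝ)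
    (hb1 : ContDiff ℝ (⊤ : ℕ∞) b1) (hb3 : ContDiff ℝ (⊤ : ℕ∞) b3)
    (hc1s : ContDiff ℝ (⊤ : ℕ∞) c1) (hc3s : ContDiff ℝ (⊤ : ℕ∞) c3)
    (hb2 : ContDiff ℝ (⊤ : ℕ∞) b2) (hc2 : ContDiff ℝ (⊤ : ℕ∞) c2)

include hb1 hc1s hb2 hc2 in
lemma nf_d1 : pd1 (NF a b1 b3 c1 c3 b2 c2) = fun p => p.1 • Phi1 a b1 c1 b2 c2 p := by
  funext ⟨u, v⟩
  have e0 := (hasDerivAt_pow 2 u).sub_const (v ^ 2)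
  have e1 := bc_d1 a (g3 := b3) hb1 hb2 u v
  have e2 := bc_d1 0 (g3 := c3) hc1s hc2 u v
  simp only [zero_mul, zero_add, mul_zero] at e2
  refine (aux_vecd e0 e1 e2).deriv.trans ?_
  rw [phi1_eq]
  ext i; fin_cases i <;> simp <;> ring

include hb3 hc3s hb2 hc2 in
lemma nf_d2 : pd2 (NF a b1 b3 c1 c3 b2 c2) = fun p => p.2 • Phi2 a b3 c3 b2 c2 p := by
  funext ⟨u, v⟩
  have e0 := (hasDerivAt_pow 2 v).const_sub (u ^ 2)
  have e1 := bc_d2 a (g1 := b1) hb3 hb2 u v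
  have e2 := bc_d2 0 (g1 := c1) hc3s hc2 u v
  simp only [zero_mul, zero_add, mul_zero] at e2
  refine (aux_vecd e0 e1 e2).deriv.trans ?_
  rw [phi2_eq]
  ext i; fin_cases i <;> simp <;> ring

include hb1 hc1s hb2 hc2 in
lemma nf_d11 (p : ℝ × ℝ) : pd1 (pd1 (NF a b1 b3 c1 c3 b2 c2)) p =
    Phi1 a b1 c1 b2 c2 p + p.1 • pd1 (Phi1 a b1 c1 b2 c2) p := by
  obtain ⟨u, v⟩ := p
  rw [nf_d1 a b1 b3 c1 c3 b2 c2 hb1 hc1s hb2 hc2]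
  have := (hasDerivAt_id u).smul (aux_h1 (phi1_smooth a hb1 hc1s hb2 hc2) u v)
  refine this.deriv.trans ?_
  simp [add_comm]

include hb3 hc3s hb2 hc2 in
lemma nf_d22 (p : ℝ × ℝ) : pd2 (pd2 (NF a b1 b3 c1 c3 b2 c2)) p =
    Phi2 a b3 c3 b2 c2 p + p.2 • pd2 (Phi2 a b3 c3 b2 c2) p := by
  obtain ⟨u, v⟩ := p
  rw [nf_d2 a b1 b3 c1 c3 b2 c2 hb3 hc3s hb2 hc2]
  have := (hasDerivAt_id v).smul (aux_h2 (phi2_smooth a hb3 hc3s hb2 hc2) u v)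
  refine this.deriv.trans ?_
  simp [add_comm]

include hb1 hc1s hb2 hc2 in
lemma nf_d12 (p : ℝ × ℝ) : pd2 (pd1 (NF a b1 b3 c1 c3 b2 c2)) p =
    (p.1 * p.2) • ![0, psi b2 p, psi c2 p] := by
  obtain ⟨u, v⟩ := p
  rw [nf_d1 a b1 b3 c1 c3 b2 c2 hb1 hc1s hb2 hc2, phi1_eq]
  have := (aux_vecd (hasDerivAt_const v (2 : ℝ)) (comp1_mixed (2 * a) b1 hb2 u v)
    (comp1_mixed 0 c1 hc2 u v)).const_smul u
  refine this.deriv.trans ?_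
  ext i; fin_cases i <;> simp <;> ring

end

lemma alg_main (x y s t m : Fin 3 → ℝ) (u v r : ℝ) (hu : u ≠ 0) (hv : v ≠ 0)
    (hX : dot3 (cross3 x y) (cross3 x y) ≠ 0) :
    u * ((dot3 x x * dot3 t (cross3 x y) - 2 * v * dot3 x y * dot3 m (cross3 x y)) *
        (r / (2 * dot3 (cross3 x y) (cross3 x y)))) +
      v * (dot3 y y * dot3 s (cross3 x y) * (r / (2 * dot3 (cross3 x y) (cross3 x y)))) =
    u * v * ((dot3 (u • x) (u • x) * dot3 (y + v • t) (r • cross3 x y) -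
      2 * dot3 (u • x) (v • y) * dot3 ((u * v) • m) (r • cross3 x y) +
      dot3 (v • y) (v • y) * dot3 (x + u • s) (r • cross3 x y)) /
      (2 * (dot3 (u • x) (u • x) * dot3 (v • y) (v • y) - dot3 (u • x) (v • y) ^ 2))) := by
  have hD : dot3 (u • x) (u • x) * dot3 (v • y) (v • y) - dot3 (u • x) (v • y) ^ 2 =
      u ^ 2 * v ^ 2 * dot3 (cross3 x y) (cross3 x y) := by
    simp [dot3, cross3]; ring
  have hy : dot3 (y + v • t) (r • cross3 x y) = v * r * dot3 t (cross3 x y) := by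
    simp [dot3, cross3]; ring
  have hx : dot3 (x + u • s) (r • cross3 x y) = u * r * dot3 s (cross3 x y) := by
    simp [dot3, cross3]; ring
  have hm : dot3 ((u * v) • m) (r • cross3 x y) = u * v * r * dot3 m (cross3 x y) := by
    simp [dot3]; ring
  have h1 : dot3 (u • x) (u • x) = u ^ 2 * dot3 x x := by simp [dot3]; ring
  have h2 : dot3 (v • y) (v • y) = v ^ 2 * dot3 y y := by simp [dot3]; ring
  have h3 : dot3 (u • x) (v • y) = u * v * dot3 x y := by simp [dot3]; ring
  rw [hD, hy, hx, hm, h1, h2, h3]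
  generalize dot3 (cross3 x y) (cross3 x y) = D at *
  field_simp
  try ring

/-- behaviour of the mean curvature at the `D₄⁺`-singularity. -/
theorem stmt_7     (a : ℝ) (b1 b3 c1 c3 : ℝ → ℝ) (b2 c2 : ℝ × ℝ → ℝ)
    (hb1 : ContDiff ℝ (⊤ : ℕ∞) b1) (hb3 : ContDiff ℝ (⊤ : ℕ∞) b3)
    (hc1s : ContDiff ℝ (⊤ : ℕ∞) c1) (hc3s : ContDiff ℝ (⊤ : ℕ∞) c3)
    (hb2 : ContDiff ℝ (⊤ : ℕ∞) b2) (hc2 : ContDiff ℝ (⊤ : ℕ∞) c2)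
    (ha : 0 < a) :
    ∃ U : Set (ℝ × ℝ), IsOpen U ∧ (0 : ℝ × ℝ) ∈ U ∧
      ∃ h : ℝ × ℝ → ℝ, ContDiffOn ℝ 1 h U ∧
        (∀ p ∈ U, p.1 * p.2 ≠ 0 → h p = p.1 * p.2 * Hm a b1 b3 c1 c3 b2 c2 p) ∧
        h 0 = 0 ∧
        pd1 h 0 = 3 * (1 + a ^ 2) * c3 0 / (32 * a ^ 2) ∧
        pd2 h 0 = 3 * (1 + a ^ 2) * c1 0 / (32 * a ^ 2) := by
  have s1 := phi1_smooth a hb1 hc1s hb2 hc2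
  have s2 := phi2_smooth a hb3 hc3s hb2 hc2
  have d11 := nf_d11 a b1 b3 c1 c3 b2 c2 hb1 hc1s hb2 hc2
  have d22 := nf_d22 a b1 b3 c1 c3 b2 c2 hb3 hc3s hb2 hc2
  have d12 := nf_d12 a b1 b3 c1 c3 b2 c2 hb1 hc1s hb2 hc2
  have d1 := nf_d1 a b1 b3 c1 c3 b2 c2 hb1 hc1s hb2 hc2
  have d2 := nf_d2 a b1 b3 c1 c3 b2 c2 hb3 hc3s hb2 hc2
  have z1 : Phi1 a b1 c1 b2 c2 0 = ![2, 2 * a, 0] := by simp [Phi1]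
  have z2 : Phi2 a b3 c3 b2 c2 0 = ![-2, 2 * a, 0] := by simp [Phi2]
  have y1 : pd1 (Phi1 a b1 c1 b2 c2) 0 = ![0, 3 * b1 0, 3 * c1 0] := by
    rw [phi1_eq]
    exact (aux_vecd (hasDerivAt_const 0 (2 : ℝ)) (comp1_zero (2 * a) b2 hb1)
      (comp1_zero 0 c2 hc1s)).deriv
  have y2 : pd2 (Phi2 a b3 c3 b2 c2) 0 = ![0, 3 * b3 0, 3 * c3 0] := by
    rw [phi2_eq]
    exact (aux_vecd (hasDerivAt_const 0 (-2 : ℝ)) (comp2_zero (2 * a) b2 hb3)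
      (comp2_zero 0 c2 hc3s)).deriv
  have s11 := aux_c1 s1
  have s22 := aux_c2 s2
  have sm : ContDiff ℝ (⊤ : ℕ∞) (fun p => (![0, psi b2 p, psi c2 p] : Fin 3 → ℝ)) :=
    aux_vec contDiff_const (psi_smooth hb2) (psi_smooth hc2)
  unfold Hm nuNF norm3
  simp only [d11, d22, d12]
  rw [d1, d2]
  clear d11 d22 d12 d1 d2
  generalize Phi1 a b1 c1 b2 c2 = P at *
  generalize Phi2 a b3 c3 b2 c2 = Q at *
  obtain ⟨m, hm⟩ : ∃ m : ℝ × ℝ → Fin 3 → ℝ, m = fun p => ![0, psi b2 p, psi c2 p] := ⟨_, rfl⟩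
  rw [← hm] at sm
  have hm' : ∀ p, ![0, psi b2 p, psi c2 p] = m p := fun p => by rw [hm]
  simp only [hm']
  have sX := aux_cross s1 s2
  have sD := aux_dot sX sX
  obtain ⟨W, hW⟩ : ∃ W : ℝ × ℝ → ℝ, W = fun p =>
    (√(dot3 (cross3 (P p) (Q p)) (cross3 (P p) (Q p))))⁻¹ /
      (2 * dot3 (cross3 (P p) (Q p)) (cross3 (P p) (Q p))) := ⟨_, rfl⟩
  obtain ⟨A, hA⟩ : ∃ A : ℝ × ℝ → ℝ, A = fun p =>
    (dot3 (P p) (P p) * dot3 (pd2 Q p) (cross3 (P p) (Q p)) -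
      2 * p.2 * dot3 (P p) (Q p) * dot3 (m p) (cross3 (P p) (Q p))) * W p := ⟨_, rfl⟩
  obtain ⟨B, hB⟩ : ∃ B : ℝ × ℝ → ℝ, B = fun p =>
    dot3 (Q p) (Q p) * dot3 (pd1 P p) (cross3 (P p) (Q p)) * W p := ⟨_, rfl⟩
  have D0 : dot3 (cross3 (P 0) (Q 0)) (cross3 (P 0) (Q 0)) = (8 * a) ^ 2 := by
    rw [z1, z2]; simp [dot3, cross3]; ring
  have D0' : (0 : ℝ) < (8 * a) ^ 2 := by positivity
  have W0 : W 0 = (8 * a)⁻¹ / (2 * (8 * a) ^ 2) := by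
    rw [hW]; simp only [D0]; rw [Real.sqrt_sq (by positivity)]
  have A0 : A 0 = 3 * (1 + a ^ 2) * c3 0 / (32 * a ^ 2) := by
    rw [hA]; simp only [W0, y2, z1, z2]; simp [dot3, cross3]; field_simp; ring
  have B0 : B 0 = 3 * (1 + a ^ 2) * c1 0 / (32 * a ^ 2) := by
    rw [hB]; simp only [W0, y1, z1, z2]; simp [dot3, cross3]; field_simp; ring
  have hWc : ∀ p, dot3 (cross3 (P p) (Q p)) (cross3 (P p) (Q p)) ≠ 0 →
      ContDiffAt ℝ (⊤ : ℕ∞) W p := by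
    intro p hp
    rw [hW]
    have hpos : 0 ≤ dot3 (cross3 (P p) (Q p)) (cross3 (P p) (Q p)) := by
      unfold dot3; nlinarith
    refine ((sD.contDiffAt.sqrt hp).inv ?_).div (contDiffAt_const.mul sD.contDiffAt) (by simpa using hp)
    exact (Real.sqrt_pos.2 (lt_of_le_of_ne hpos (Ne.symm hp))).ne'
  have hAc : ∀ p, dot3 (cross3 (P p) (Q p)) (cross3 (P p) (Q p)) ≠ 0 →
      ContDiffAt ℝ (⊤ : ℕ∞) A p := by
    intro p hp
    rw [hA]
    exact (((aux_dot s1 s1).mul (aux_dot s22 sX)).sub (((contDiff_const.mul contDiff_snd).mul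
      (aux_dot s1 s2)).mul (aux_dot sm sX))).contDiffAt.mul (hWc p hp)
  have hBc : ∀ p, dot3 (cross3 (P p) (Q p)) (cross3 (P p) (Q p)) ≠ 0 →
      ContDiffAt ℝ (⊤ : ℕ∞) B p := by
    intro p hp
    rw [hB]
    exact ((aux_dot s2 s2).mul (aux_dot s11 sX)).contDiffAt.mul (hWc p hp)
  have dA : DifferentiableAt ℝ A 0 :=
    (hAc 0 (by rw [D0]; exact D0'.ne')).differentiableAt (by simp)
  have dB : DifferentiableAt ℝ B 0 :=
    (hBc 0 (by rw [D0]; exact D0'.ne')).differentiableAt (by simp)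
  refine ⟨{p | dot3 (cross3 (P p) (Q p)) (cross3 (P p) (Q p)) ≠ 0},
    isOpen_ne_fun sD.continuous continuous_const, by
      rw [Set.mem_setOf_eq, D0]; exact D0'.ne', fun p => p.1 * A p + p.2 * B p, ?_, ?_, ?_, ?_, ?_⟩
  · intro p hp
    exact (((contDiffAt_fst.mul (hAc p hp)).add (contDiffAt_snd.mul (hBc p hp))).of_le
      (by exact_mod_cast le_top)).contDiffWithinAt
  · intro p hp huv
    have hu := left_ne_zero_of_mul huv
    have hv := right_ne_zero_of_mul huv
    rw [hA, hB, hW]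
    exact alg_main (P p) (Q p) (pd1 P p) (pd2 Q p) (m p) p.1 p.2 _ hu hv hp
  · simp
  · rw [← A0]
    have := (hasDerivAt_id (0 : ℝ)).mul (aux_pd1_has dA)
    have e : pd1 (fun p => p.1 * A p + p.2 * B p) 0 = deriv (id * fun u => A (u, 0)) 0 := by
      unfold pd1; congr 1; funext u; simp
    rw [e]
    refine this.deriv.trans ?_
    simp
    rfl
  · rw [← B0]
    have := (hasDerivAt_id (0 : ℝ)).mul (aux_pd2_has dB)
    have e : pd2 (fun p => p.1 * A p + p.2 * B p) 0 = deriv (id * fun u => B (0, u)) 0 := by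
      unfold pd2; congr 1; funext u; simp
    rw [e]
    refine this.deriv.trans ?_
    simp
    rfl
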